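/- arXiv:1107.0802 — 2 statements merged into one kernel-verified Lean document; each statement's English description precedes it below -/
import Mathlib

section
/- Let Λ > 0, U > 0 and R ≥ r_c := √(3/Λ), and let h₀ ∈ C⁰([0,∞)). Then the map F is a contraction on the Banach space C⁰([0,U]×[0,R]) with the sup norm: there exists σ < 1 such that ‖F(h₁) − F(h₂)‖_{C⁰([0,U]×[0,R])} ≤ σ ‖h₁ − h₂‖_{C⁰([0,U]×[0,R])} for all continuous h₁, h₂ on [0,U]×[0,R]. -/
open Real Set

/-- The spherical mean `h̄(u,r) = (1/r) ∫₀^r h(u,s) ds`, with `h̄(u,0) = h(u,0)`. -/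
noncomputable def hbar (h : ℝ → ℝ → ℝ) (u r : ℝ) : ℝ :=
  if r = 0 then h u 0 else (∫ s in (0:ℝ)..r, h u s) / r

/-- `χ` is the characteristic through `(u₁,r₁)`: it solves
`χ' = -(1/2)(1 - (Λ/3) χ²)` on `[0,u₁]` with `χ(u₁) = r₁`. -/
def IsChar (Λ u₁ r₁ : ℝ) (χ : ℝ → ℝ) : Prop :=
  χ u₁ = r₁ ∧ ∀ s ∈ Set.Icc 0 u₁, HasDerivAt χ (-(1/2) * (1 - Λ/3 * (χ s)^2)) s

/-- The value of the operator `F` at `(u₁, r₁)`, computed along the characteristic `χ`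
through `(u₁,r₁)`:
`F(h)(u₁,r₁) = h₀(χ(0)) e^{-(Λ/3)∫₀^{u₁} χ} + (Λ/3) ∫₀^{u₁} χ(v) h̄(v,χ(v)) e^{-(Λ/3)∫_v^{u₁} χ} dv`. -/
noncomputable def Fval (Λ : ℝ) (χ : ℝ → ℝ) (h₀ : ℝ → ℝ) (h : ℝ → ℝ → ℝ) (u₁ : ℝ) : ℝ :=
  h₀ (χ 0) * Real.exp (-(Λ/3) * ∫ s in (0:ℝ)..u₁, χ s)
    + (Λ/3) * ∫ v in (0:ℝ)..u₁,
        χ v * hbar h v (χ v) * Real.exp (-(Λ/3) * ∫ s in v..u₁, χ s)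

theorem mul_hbar (h : ℝ → ℝ → ℝ) (u r : ℝ) : r * hbar h u r = ∫ s in (0:ℝ)..r, h u s := by
  unfold hbar
  split_ifs with hr
  · simp [hr]
  · field_simp

theorem hasDerivAt_exp_neg_mul_integral_left {c : ℝ → ℝ} (hc : Continuous c) (k u v : ℝ) :
    HasDerivAt (fun v => Real.exp (-k * ∫ s in v..u, c s))
      (k * (c v * Real.exp (-k * ∫ s in v..u, c s))) v := by
  have h := intervalIntegral.integral_hasDerivAt_left (hc.intervalIntegrable v u)
    hc.stronglyMeasurable.stronglyMeasurableAtFilter hc.continuousAt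
  convert (h.const_mul (-k)).exp using 1
  ring

theorem continuous_exp_neg_mul_integral_left {c : ℝ → ℝ} (hc : Continuous c) (k u : ℝ) :
    Continuous (fun v => Real.exp (-k * ∫ s in v..u, c s)) :=
  continuous_iff_continuousAt.2 fun v =>
    (hasDerivAt_exp_neg_mul_integral_left hc k u v).continuousAt

theorem mul_integral_mul_exp_neg_mul_integral {c : ℝ → ℝ} (hc : Continuous c) (k u : ℝ) :
    k * ∫ v in (0:ℝ)..u, c v * Real.exp (-k * ∫ s in v..u, c s)
      = 1 - Real.exp (-k * ∫ s in (0:ℝ)..u, c s) := by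
  have hE := continuous_exp_neg_mul_integral_left hc k u
  rw [← intervalIntegral.integral_const_mul,
    intervalIntegral.integral_eq_sub_of_hasDerivAt
      (fun v _ => hasDerivAt_exp_neg_mul_integral_left hc k u v)
      ((continuous_const.mul (hc.mul hE)).intervalIntegrable _ _)]
  simp

/-- The primitive of `h` in its second variable is continuous along a continuous curve. -/
theorem continuousOn_integral_along {U R u : ℝ} (hU : 0 ≤ U) (hR : 0 ≤ R) (hu : u ≤ U)
    {h : ℝ → ℝ → ℝ}
    (hh : ContinuousOn (fun q : ℝ × ℝ => h q.1 q.2) (Set.Icc 0 U ×ˢ Set.Icc 0 R))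
    {c : ℝ → ℝ} (hc : Continuous c) (hcR : ∀ v, c v ∈ Set.Icc 0 R) :
    ContinuousOn (fun v => ∫ s in (0:ℝ)..c v, h v s) (Set.Icc 0 u) := by
  have hH : Continuous (fun q : ℝ × ℝ =>
      h (Set.projIcc 0 U hU q.1) (Set.projIcc 0 R hR q.2)) :=
    hh.comp_continuous
      (f := fun q : ℝ × ℝ => ((Set.projIcc 0 U hU q.1 : ℝ), (Set.projIcc 0 R hR q.2 : ℝ)))
      (by fun_prop) (fun q => ⟨Subtype.prop _, Subtype.prop _⟩)
  have hG : Continuous (fun v => ∫ s in (0:ℝ)..c v,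
      h (Set.projIcc 0 U hU v) (Set.projIcc 0 R hR s)) :=
    intervalIntegral.continuous_parametric_intervalIntegral_of_continuous hH hc
  refine hG.continuousOn.congr fun v hv => intervalIntegral.integral_congr fun s hs => ?_
  rw [Set.uIcc_of_le (hcR v).1] at hs
  simp only [Set.projIcc_of_mem hU ⟨hv.1, hv.2.trans hu⟩,
    Set.projIcc_of_mem hR ⟨hs.1, hs.2.trans (hcR v).2⟩]

theorem Fval_congr {Λ u : ℝ} (hu : 0 ≤ u) {χ c : ℝ → ℝ} (hχ : Set.EqOn χ c (Set.Icc 0 u))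
    (h₀ : ℝ → ℝ) (h : ℝ → ℝ → ℝ) : Fval Λ χ h₀ h u = Fval Λ c h₀ h u := by
  have hint : ∀ v ∈ Set.Icc 0 u, ∫ s in v..u, χ s = ∫ s in v..u, c s := fun v hv =>
    intervalIntegral.integral_congr fun s hs => by
      rw [Set.uIcc_of_le hv.2] at hs
      exact hχ ⟨hv.1.trans hs.1, hs.2⟩
  unfold Fval
  rw [hχ ⟨le_rfl, hu⟩, hint 0 ⟨le_rfl, hu⟩]
  congr 2
  refine intervalIntegral.integral_congr fun v hv => ?_
  rw [Set.uIcc_of_le hu] at hv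
  simp only [hχ hv, hint v hv]

theorem abs_Fval_sub_le {Λ U R u : ℝ} (hΛ : 0 < Λ) (hR : 0 ≤ R) (hu : u ∈ Set.Icc 0 U)
    {c : ℝ → ℝ} (hc : Continuous c) (hcR : ∀ v, c v ∈ Set.Icc 0 R) (h₀ : ℝ → ℝ)
    {h₁ h₂ : ℝ → ℝ → ℝ}
    (hh₁ : ContinuousOn (fun q : ℝ × ℝ => h₁ q.1 q.2) (Set.Icc 0 U ×ˢ Set.Icc 0 R))
    (hh₂ : ContinuousOn (fun q : ℝ × ℝ => h₂ q.1 q.2) (Set.Icc 0 U ×ˢ Set.Icc 0 R))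
    {M : ℝ} (hM : ∀ u r, u ∈ Set.Icc 0 U → r ∈ Set.Icc 0 R → |h₁ u r - h₂ u r| ≤ M) :
    |Fval Λ c h₀ h₁ u - Fval Λ c h₀ h₂ u|
      ≤ (1 - Real.exp (-(Λ/3) * ∫ s in (0:ℝ)..u, c s)) * M := by
  have hU : 0 ≤ U := hu.1.trans hu.2
  have hE := continuous_exp_neg_mul_integral_left hc (Λ/3) u
  have hint : ∀ h : ℝ → ℝ → ℝ,
      ContinuousOn (fun q : ℝ × ℝ => h q.1 q.2) (Set.Icc 0 U ×ˢ Set.Icc 0 R) →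
      IntervalIntegrable (fun v => (∫ s in (0:ℝ)..c v, h v s)
        * Real.exp (-(Λ/3) * ∫ s in v..u, c s)) MeasureTheory.volume 0 u := fun h hh => by
    apply ContinuousOn.intervalIntegrable
    rw [Set.uIcc_of_le hu.1]
    exact (continuousOn_integral_along hU hR hu.2 hh hc hcR).mul hE.continuousOn
  have hslice : ∀ h : ℝ → ℝ → ℝ,
      ContinuousOn (fun q : ℝ × ℝ => h q.1 q.2) (Set.Icc 0 U ×ˢ Set.Icc 0 R) →
      ∀ v ∈ Set.Icc 0 U, ∀ r ∈ Set.Icc 0 R,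
        IntervalIntegrable (h v) MeasureTheory.volume 0 r := fun h hh v hv r hr => by
    apply ContinuousOn.intervalIntegrable
    rw [Set.uIcc_of_le hr.1]
    exact hh.comp (f := fun s => (v, s)) (by fun_prop)
      (fun s hs => ⟨hv, hs.1, hs.2.trans hr.2⟩)
  unfold Fval
  simp only [mul_hbar]
  rw [add_sub_add_left_eq_sub, ← mul_sub, ← intervalIntegral.integral_sub (hint h₁ hh₁) (hint h₂ hh₂),
    abs_mul, abs_of_pos (by positivity : 0 < Λ/3), ← mul_integral_mul_exp_neg_mul_integral hc,
    mul_assoc, ← intervalIntegral.integral_mul_const]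
  refine mul_le_mul_of_nonneg_left ?_ (by positivity)
  rw [← Real.norm_eq_abs]
  refine intervalIntegral.norm_integral_le_of_norm_le hu.1
    (Filter.Eventually.of_forall fun v hv => ?_)
    (((hc.mul hE).mul continuous_const).intervalIntegrable _ _)
  have hvU : v ∈ Set.Icc 0 U := ⟨hv.1.le, hv.2.trans hu.2⟩
  rw [← sub_mul, ← intervalIntegral.integral_sub (hslice h₁ hh₁ v hvU _ (hcR v))
    (hslice h₂ hh₂ v hvU _ (hcR v)), norm_mul, Real.norm_of_nonneg (Real.exp_pos _).le]
  have hb : ‖∫ s in (0:ℝ)..c v, (h₁ v s - h₂ v s)‖ ≤ M * |c v - 0| := by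
    refine intervalIntegral.norm_integral_le_of_norm_le_const fun s hs => ?_
    rw [Set.uIoc_of_le (hcR v).1] at hs
    exact hM v s hvU ⟨hs.1.le, hs.2.trans (hcR v).2⟩
  rw [sub_zero, abs_of_nonneg (hcR v).1] at hb
  calc _ ≤ M * c v * Real.exp (-(Λ/3) * ∫ s in v..u, c s) := by gcongr
    _ = _ := by ring

/-- For `U > 0` and `R ≥ r_c = √(3/Λ)`, the map `F` is a contraction
on `C⁰([0,U] × [0,R])` with the sup norm: there is `σ < 1` such that
`‖F(h₁) - F(h₂)‖_{C⁰} ≤ σ ‖h₁ - h₂‖_{C⁰}`. -/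
theorem F_contraction
    (Λ : ℝ) (hΛ : 0 < Λ) (U R : ℝ) (hU : 0 < U) (hR : Real.sqrt (3 / Λ) ≤ R)
    (h₀ : ℝ → ℝ) (h₀cont : ContinuousOn h₀ (Set.Ici 0))
    (χ : ℝ → ℝ → ℝ → ℝ)
    (hχ : ∀ u₁ r₁, u₁ ∈ Set.Icc 0 U → r₁ ∈ Set.Icc 0 R →
      IsChar Λ u₁ r₁ (χ u₁ r₁) ∧ ∀ s ∈ Set.Icc 0 u₁, χ u₁ r₁ s ∈ Set.Icc 0 R) :
    ∃ σ : ℝ, 0 ≤ σ ∧ σ < 1 ∧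
      ∀ h₁ h₂ : ℝ → ℝ → ℝ,
        ContinuousOn (fun q : ℝ × ℝ => h₁ q.1 q.2) (Set.Icc 0 U ×ˢ Set.Icc 0 R) →
        ContinuousOn (fun q : ℝ × ℝ => h₂ q.1 q.2) (Set.Icc 0 U ×ˢ Set.Icc 0 R) →
        ∀ M : ℝ,
          (∀ u r, u ∈ Set.Icc 0 U → r ∈ Set.Icc 0 R → |h₁ u r - h₂ u r| ≤ M) →
          ∀ u₁ r₁, u₁ ∈ Set.Icc 0 U → r₁ ∈ Set.Icc 0 R →
            |Fval Λ (χ u₁ r₁) h₀ h₁ u₁ - Fval Λ (χ u₁ r₁) h₀ h₂ u₁| ≤ σ * M := by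
  have hR0 : 0 ≤ R := (Real.sqrt_nonneg _).trans hR
  refine ⟨1 - Real.exp (-(Λ/3) * (R * U)), ?_, by linarith [Real.exp_pos (-(Λ/3) * (R * U))], ?_⟩
  · rw [sub_nonneg, Real.exp_le_one_iff, neg_mul, neg_nonpos]
    positivity
  intro h₁ h₂ hh₁ hh₂ M hM u r hu hr
  obtain ⟨⟨-, hder⟩, hmem⟩ := hχ u r hu hr
  have hcont : ContinuousOn (χ u r) (Set.Icc 0 u) := fun s hs =>
    (hder s hs).continuousAt.continuousWithinAt
  set c : ℝ → ℝ := fun s => χ u r (Set.projIcc 0 u hu.1 s)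
  have hc : Continuous c :=
    hcont.comp_continuous (by fun_prop) (fun s => Subtype.prop _)
  have hcR : ∀ s, c s ∈ Set.Icc 0 R := fun s => hmem _ (Subtype.prop _)
  have heq : Set.EqOn (χ u r) c (Set.Icc 0 u) := fun s hs => by
    simp only [c, Set.projIcc_of_mem hu.1 hs]
  have hM0 : 0 ≤ M := (abs_nonneg _).trans (hM u r hu hr)
  have hI : ∫ s in (0:ℝ)..u, c s ≤ R * U := by
    calc ∫ s in (0:ℝ)..u, c s ≤ ∫ _ in (0:ℝ)..u, R :=
          intervalIntegral.integral_mono_on hu.1 (hc.intervalIntegrable _ _)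
            (continuous_const.intervalIntegrable _ _) (fun s _ => (hcR s).2)
      _ = R * u := by simp [mul_comm]
      _ ≤ R * U := mul_le_mul_of_nonneg_left hu.2 hR0
  rw [Fval_congr hu.1 heq, Fval_congr hu.1 heq]
  refine (abs_Fval_sub_le hΛ hR0 hu hc hcR h₀ hh₁ hh₂ hM).trans
    (mul_le_mul_of_nonneg_right (sub_le_sub_left (Real.exp_le_exp.2 ?_) 1) hM0)
  exact mul_le_mul_of_nonpos_left hI (by linarith)
end

section
/- Let Λ > 0 and let h ∈ C²([0,∞)×[0,∞)) satisfy Dh = −(Λ/3) r (h − h̄). Then g := ∂h/∂r satisfies Dg = −(2Λ/3) r g on [0,∞)×[0,∞). -/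
open Real Set

/-- Partial derivative in the `u` direction (within `[0,∞)`). -/
noncomputable def pderivU (h : ℝ → ℝ → ℝ) (u r : ℝ) : ℝ :=
  derivWithin (fun u' => h u' r) (Set.Ici 0) u

/-- Partial derivative in the `r` direction (within `[0,∞)`). -/
noncomputable def pderivR (h : ℝ → ℝ → ℝ) (u r : ℝ) : ℝ :=
  derivWithin (fun r' => h u r') (Set.Ici 0) r

/-- `h` solves `Dh = -(Λ/3) r (h - h̄)` on `[0,∞) × [0,∞)`. -/
def IsSol (Λ : ℝ) (h : ℝ → ℝ → ℝ) : Prop :=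
  ∀ u r : ℝ, 0 ≤ u → 0 ≤ r →
    pderivU h u r - (1/2) * (1 - Λ/3 * r^2) * pderivR h u r
      = -(Λ/3) * r * (h u r - hbar h u r)

/-- A derivative within a product set restricts to the slice in the first variable. -/
theorem HasFDerivWithinAt.hasDerivWithinAt_slice_left {E : Type*} [NormedAddCommGroup E]
    [NormedSpace ℝ E] {f : ℝ × ℝ → E} {f' : ℝ × ℝ →L[ℝ] E} {s t : Set ℝ} {u r : ℝ}
    (hf : HasFDerivWithinAt f f' (s ×ˢ t) (u, r)) (hr : r ∈ t) :
    HasDerivWithinAt (fun u' => f (u', r)) (f' (1, 0)) s u :=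
  hf.comp_hasDerivWithinAt u ((hasDerivWithinAt_id u s).prodMk (hasDerivWithinAt_const u s r))
    fun _ hx => Set.mk_mem_prod hx hr

/-- A derivative within a product set restricts to the slice in the second variable. -/
theorem HasFDerivWithinAt.hasDerivWithinAt_slice_right {E : Type*} [NormedAddCommGroup E]
    [NormedSpace ℝ E] {f : ℝ × ℝ → E} {f' : ℝ × ℝ →L[ℝ] E} {s t : Set ℝ} {u r : ℝ}
    (hf : HasFDerivWithinAt f f' (s ×ˢ t) (u, r)) (hu : u ∈ s) :
    HasDerivWithinAt (fun r' => f (u, r')) (f' (0, 1)) t r :=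
  hf.comp_hasDerivWithinAt r ((hasDerivWithinAt_const r t u).prodMk (hasDerivWithinAt_id r t))
    fun _ hx => Set.mk_mem_prod hu hx

/-- The fundamental theorem of calculus on `[0,∞)`, with one-sided derivative at `0`. -/
theorem hasDerivWithinAt_integral_Ici {k : ℝ → ℝ} (hk : ContinuousOn k (Ici 0)) {r : ℝ}
    (hr : 0 ≤ r) : HasDerivWithinAt (fun x => ∫ s in (0:ℝ)..x, k s) (k r) (Ici 0) r := by
  have hc : Continuous fun s => k (max s 0) :=
    hk.comp_continuous (by fun_prop) fun s => le_max_right s 0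
  have hd := (hc.integral_hasStrictDerivAt 0 r).hasDerivAt.hasDerivWithinAt (s := Ici 0)
  simp only [max_eq_left hr] at hd
  have hEq : ∀ x ∈ Ici (0:ℝ), ∫ s in (0:ℝ)..x, k s = ∫ s in (0:ℝ)..x, k (max s 0) := by
    intro x hx
    refine intervalIntegral.integral_congr fun s hs => ?_
    rw [uIcc_of_le hx] at hs
    simp only [max_eq_left hs.1]
  exact hd.congr hEq (hEq r hr)

theorem mul_sub_hbar (h : ℝ → ℝ → ℝ) (u r : ℝ) :
    r * (h u r - hbar h u r) = r * h u r - ∫ s in (0:ℝ)..r, h u s := by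
  by_cases hr : r = 0
  · simp [hr]
  · rw [hbar, if_neg hr]
    field_simp

/-- If `h ∈ C²([0,∞)²)` satisfies `Dh = -(Λ/3) r (h - h̄)`, then
`g = ∂h/∂r` satisfies `Dg = -(2Λ/3) r g` on `[0,∞) × [0,∞)`. -/
theorem radial_derivative_equation
    (Λ : ℝ) (hΛ : 0 < Λ) (h : ℝ → ℝ → ℝ)
    (hreg : ContDiffOn ℝ 2 (fun p : ℝ × ℝ => h p.1 p.2) (Set.Ici 0 ×ˢ Set.Ici 0))
    (hsol : IsSol Λ h) :
    ∀ u r : ℝ, 0 ≤ u → 0 ≤ r →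
      pderivU (pderivR h) u r - (1/2) * (1 - Λ/3 * r^2) * pderivR (pderivR h) u r
        = -(2 * Λ / 3) * r * pderivR h u r := by
  intro u r hu hr
  set S : Set (ℝ × ℝ) := Ici 0 ×ˢ Ici 0 with hS
  set f : ℝ × ℝ → ℝ := fun p => h p.1 p.2
  have hUI : UniqueDiffOn ℝ (Ici (0:ℝ)) := uniqueDiffOn_Ici 0
  have hUS : UniqueDiffOn ℝ S := hUI.prod hUI
  have hF : ∀ a b : ℝ, 0 ≤ a → 0 ≤ b →
      HasFDerivWithinAt f (fderivWithin ℝ f S (a, b)) S (a, b) := fun a b ha hb =>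
    (hreg.differentiableOn (by norm_num) (a, b) ⟨ha, hb⟩).hasFDerivWithinAt
  have hRd : ∀ a b : ℝ, 0 ≤ a → 0 ≤ b →
      HasDerivWithinAt (h a) (fderivWithin ℝ f S (a, b) (0, 1)) (Ici 0) b :=
    fun a b ha hb => (hF a b ha hb).hasDerivWithinAt_slice_right ha
  have hU : ∀ a b : ℝ, 0 ≤ a → 0 ≤ b → pderivU h a b = fderivWithin ℝ f S (a, b) (1, 0) :=
    fun a b ha hb => ((hF a b ha hb).hasDerivWithinAt_slice_left hb).derivWithin (hUI a ha)
  have hR : ∀ a b : ℝ, 0 ≤ a → 0 ≤ b → pderivR h a b = fderivWithin ℝ f S (a, b) (0, 1) :=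
    fun a b ha hb => (hRd a b ha hb).derivWithin (hUI b hb)
  have hmem : (u, r) ∈ S := ⟨hu, hr⟩
  set F2 := fderivWithin ℝ (fderivWithin ℝ f S) S (u, r)
  have hF2 : HasFDerivWithinAt (fderivWithin ℝ f S) F2 S (u, r) :=
    ((hreg.fderivWithin hUS (m := 1) (by norm_num)).differentiableOn (by norm_num)
      (u, r) hmem).hasFDerivWithinAt
  have hsymm : F2 (1, 0) (0, 1) = F2 (0, 1) (1, 0) := by
    refine (hreg (u, r) hmem).isSymmSndFDerivWithinAt (by simp) hUS ?_ hmem (1, 0) (0, 1)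
    rw [hS, interior_prod_eq, closure_prod_eq]
    simpa using And.intro hu hr
  have hleft := hF2.hasDerivWithinAt_slice_left hr
  have hright := hF2.hasDerivWithinAt_slice_right hu
  have hgu : pderivU (pderivR h) u r = F2 (1, 0) (0, 1) :=
    ((hleft.clm_apply (hasDerivWithinAt_const u (Ici 0) ((0:ℝ), (1:ℝ)))).congr
      (fun a ha => hR a r ha hr) (hR u r hu hr)).derivWithin (hUI u hu) |>.trans (by simp)
  have hgr : HasDerivWithinAt (pderivR h u) (F2 (0, 1) (0, 1)) (Ici 0) r := by
    simpa using (hright.clm_apply (hasDerivWithinAt_const r (Ici 0) ((0:ℝ), (1:ℝ)))).congr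
      (fun b hb => hR u b hu hb) (hR u r hu hr)
  have hur : HasDerivWithinAt (pderivU h u) (F2 (0, 1) (1, 0)) (Ici 0) r := by
    simpa using (hright.clm_apply (hasDerivWithinAt_const r (Ici 0) ((1:ℝ), (0:ℝ)))).congr
      (fun b hb => hU u b hu hb) (hU u r hu hr)
  have hgrr : pderivR (pderivR h) u r = F2 (0, 1) (0, 1) := hgr.derivWithin (hUI r hr)
  have hhr : HasDerivWithinAt (h u) (pderivR h u r) (Ici 0) r := hR u r hu hr ▸ hRd u r hu hr
  have hint := hasDerivWithinAt_integral_Ici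
    (fun b hb => (hRd u b hu hb).continuousWithinAt) hr
  have hid := hasDerivWithinAt_id r (Ici 0)
  have hL := hur.sub
    (((((hid.pow 2).const_mul (Λ / 3)).const_sub 1).const_mul (1 / 2)).mul hgr)
  have hRHS := ((hid.mul hhr).sub hint).const_mul (-(Λ / 3))
  have hE : ∀ b ∈ Ici (0:ℝ), -(Λ / 3) * (b * h u b - ∫ s in (0:ℝ)..b, h u s) =
      pderivU h u b - 1 / 2 * (1 - Λ / 3 * b ^ 2) * pderivR h u b := by
    intro b hb
    rw [hsol u b hu hb, mul_assoc, mul_sub_hbar]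
  have key := (hUI r hr).eq_deriv _ hL (hRHS.congr (fun b hb => (hE b hb).symm) (hE r hr).symm)
  rw [hgu, hgrr, hsymm]
  simp at key
  linarith
end
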